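/- arXiv:1306.4739 — 4 statements merged into one kernel-verified Lean document; each statement's English description precedes it below -/
import Mathlib

section
/- Let m, q, J, A be real numbers satisfying the mass–charge–angular-momentum inequality m² ≥ (q² + √(q⁴ + 4J²))/2 and the area–charge–angular-momentum inequality A ≥ 4π√(q⁴ + 4J²). Then A/(8π) ≥ m² − q²/2 − √((m² − q²/2)² − q⁴/4 − J²). -/
open Real

/-- Lower area bound: if `m² ≥ (q² + √(q⁴ + 4J²))/2` and `A ≥ 4π√(q⁴ + 4J²)`, then
`A/(8π) ≥ m² − q²/2 − √((m² − q²/2)² − q⁴/4 − J²)`. -/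
theorem lower_area_bound (m q J A : ℝ)
    (hm : m ^ 2 ≥ (q ^ 2 + Real.sqrt (q ^ 4 + 4 * J ^ 2)) / 2)
    (hA : A ≥ 4 * π * Real.sqrt (q ^ 4 + 4 * J ^ 2)) :
    A / (8 * π) ≥ m ^ 2 - q ^ 2 / 2 -
      Real.sqrt ((m ^ 2 - q ^ 2 / 2) ^ 2 - q ^ 4 / 4 - J ^ 2) := by
  have hs := Real.sqrt_nonneg (q ^ 4 + 4 * J ^ 2)
  have hsq : Real.sqrt (q ^ 4 + 4 * J ^ 2) ^ 2 = q ^ 4 + 4 * J ^ 2 :=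
    Real.sq_sqrt (by positivity)
  set s := Real.sqrt (q ^ 4 + 4 * J ^ 2)
  have harea : s / 2 ≤ A / (8 * π) := by
    rw [le_div_iff₀ (by positivity)]
    linarith
  have hroot : m ^ 2 - q ^ 2 / 2 - s / 2 ≤
      Real.sqrt ((m ^ 2 - q ^ 2 / 2) ^ 2 - q ^ 4 / 4 - J ^ 2) := by
    apply Real.le_sqrt_of_sq_le
    have hx : 0 ≤ m ^ 2 - q ^ 2 / 2 - s / 2 := by linarith
    nlinarith [mul_nonneg hs hx]
  linarith
end

section
/- Let m, q, J, A be real numbers satisfying m² ≥ (q² + √(q⁴ + 4J²))/2, A ≥ 4π√(q⁴ + 4J²), and A > 0. Then equality A/(8π) = m² − q²/2 − √((m² − q²/2)² − q⁴/4 − J²) holds if and only if m² = (q² + √(q⁴ + 4J²))/2 and A = 4π√(q⁴ + 4J²) (the extreme case). -/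
open Real

/-- For `0 ≤ c ≤ x` and `0 < a` with `c ≤ a`, the number `a` is the smaller root of
`t² - 2xt + c²` only if `x = c` and `a = c`. -/
theorem eq_and_eq_of_eq_sub_sqrt {x a c : ℝ} (hc : 0 ≤ c) (hx : c ≤ x) (ha : 0 < a)
    (hca : c ≤ a) (h : a = x - √(x ^ 2 - c ^ 2)) : x = c ∧ a = c := by
  have hy := Real.sqrt_nonneg (x ^ 2 - c ^ 2)
  have hy2 := Real.sq_sqrt (show 0 ≤ x ^ 2 - c ^ 2 by nlinarith)
  set y := √(x ^ 2 - c ^ 2)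
  have hprod : a * (x + y) = c ^ 2 := by rw [h]; linarith
  have hac : a = c := by
    refine le_antisymm (abs_le_of_sq_le_sq' ?_ hc).2 hca
    nlinarith
  have hsum : x + y = c := by
    apply mul_left_cancel₀ ha.ne'
    rw [hprod, hac, sq]
  exact ⟨by linarith, hac⟩

/-- Rigidity: under `m² ≥ (q² + √(q⁴ + 4J²))/2`, `A ≥ 4π√(q⁴ + 4J²)`, and `A > 0`,
equality `A/(8π) = m² − q²/2 − √((m² − q²/2)² − q⁴/4 − J²)` holds iff
`m² = (q² + √(q⁴ + 4J²))/2` and `A = 4π√(q⁴ + 4J²)` (the extreme case). -/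
theorem lower_area_bound_rigidity (m q J A : ℝ)
    (hm : m ^ 2 ≥ (q ^ 2 + Real.sqrt (q ^ 4 + 4 * J ^ 2)) / 2)
    (hA : A ≥ 4 * π * Real.sqrt (q ^ 4 + 4 * J ^ 2))
    (hApos : 0 < A) :
    A / (8 * π) = m ^ 2 - q ^ 2 / 2 -
        Real.sqrt ((m ^ 2 - q ^ 2 / 2) ^ 2 - q ^ 4 / 4 - J ^ 2) ↔
      m ^ 2 = (q ^ 2 + Real.sqrt (q ^ 4 + 4 * J ^ 2)) / 2 ∧
        A = 4 * π * Real.sqrt (q ^ 4 + 4 * J ^ 2) := by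
  have hs := Real.sqrt_nonneg (q ^ 4 + 4 * J ^ 2)
  have hs2 := Real.sq_sqrt (show 0 ≤ q ^ 4 + 4 * J ^ 2 by positivity)
  set s := √(q ^ 4 + 4 * J ^ 2)
  have hπ := Real.pi_pos
  have hdisc : (m ^ 2 - q ^ 2 / 2) ^ 2 - q ^ 4 / 4 - J ^ 2 =
      (m ^ 2 - q ^ 2 / 2) ^ 2 - (s / 2) ^ 2 := by linarith
  rw [hdisc]
  constructor
  · intro h
    have hsA : s / 2 ≤ A / (8 * π) := by
      rw [le_div_iff₀ (by positivity)]
      linarith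
    obtain ⟨hx, ha⟩ := eq_and_eq_of_eq_sub_sqrt (by positivity) (by linarith)
      (by positivity) hsA h
    rw [div_eq_iff (by positivity)] at ha
    exact ⟨by linarith, by linarith⟩
  · rintro ⟨hmass, harea⟩
    have hx : m ^ 2 - q ^ 2 / 2 = s / 2 := by linarith
    rw [hx, sub_self, Real.sqrt_zero, sub_zero, harea, div_eq_iff (by positivity)]
    ring
end

section
/- Let E, A : ℝ³ → ℝ³ be continuously differentiable vector fields and let η : ℝ³ → ℝ³ be the rotational vector field η(x, y, z) = (−y, x, 0). Assume E is divergence-free (div E = 0) and axially symmetric in the sense that its Lie bracket with η vanishes: (η·∇)E = (E·∇)η pointwise. Then at every point of ℝ³, ⟨E × curl A, η⟩ = div( ⟨E, A⟩·η − ⟨A, η⟩·E ), i.e., the angular component of the electromagnetic momentum density E × B with B = curl A is a total divergence. -/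
open Real

noncomputable section

/-- Partial derivative in the `i`-th coordinate direction of a scalar function on ℝ³. -/
def pd (i : Fin 3) (f : (Fin 3 → ℝ) → ℝ) (x : Fin 3 → ℝ) : ℝ :=
  fderiv ℝ f x (Pi.single i 1)

/-- Euclidean dot product on ℝ³. -/
def dot3 (u v : Fin 3 → ℝ) : ℝ := ∑ i, u i * v i

/-- Cross product on ℝ³. -/
def cross3 (u v : Fin 3 → ℝ) : Fin 3 → ℝ :=
  ![u 1 * v 2 - u 2 * v 1, u 2 * v 0 - u 0 * v 2, u 0 * v 1 - u 1 * v 0]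

/-- Divergence of a vector field on ℝ³. -/
def div3 (F : (Fin 3 → ℝ) → Fin 3 → ℝ) (x : Fin 3 → ℝ) : ℝ :=
  ∑ i, pd i (fun y => F y i) x

/-- Curl of a vector field on ℝ³. -/
def curl3 (F : (Fin 3 → ℝ) → Fin 3 → ℝ) (x : Fin 3 → ℝ) : Fin 3 → ℝ :=
  ![pd 1 (fun y => F y 2) x - pd 2 (fun y => F y 1) x,
    pd 2 (fun y => F y 0) x - pd 0 (fun y => F y 2) x,
    pd 0 (fun y => F y 1) x - pd 1 (fun y => F y 0) x]

/-- The rotational (axial Killing) vector field `η(x, y, z) = (−y, x, 0)`. -/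
def η₃ (x : Fin 3 → ℝ) : Fin 3 → ℝ := ![-(x 1), x 0, 0]

theorem pd_mul (i : Fin 3) {f g : (Fin 3 → ℝ) → ℝ} {x : Fin 3 → ℝ}
    (hf : DifferentiableAt ℝ f x) (hg : DifferentiableAt ℝ g x) :
    pd i (fun y => f y * g y) x = f x * pd i g x + pd i f x * g x := by
  simp only [pd, fderiv_fun_mul hf hg, add_apply,
    smul_apply, smul_eq_mul]
  ring

theorem pd_sub (i : Fin 3) {f g : (Fin 3 → ℝ) → ℝ} {x : Fin 3 → ℝ}
    (hf : DifferentiableAt ℝ f x) (hg : DifferentiableAt ℝ g x) :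
    pd i (fun y => f y - g y) x = pd i f x - pd i g x := by
  simp only [pd, fderiv_fun_sub hf hg, sub_apply]

theorem pd_dot3 (i : Fin 3) {F G : (Fin 3 → ℝ) → Fin 3 → ℝ} {x : Fin 3 → ℝ}
    (hF : ∀ j, DifferentiableAt ℝ (fun y => F y j) x)
    (hG : ∀ j, DifferentiableAt ℝ (fun y => G y j) x) :
    pd i (fun y => dot3 (F y) (G y)) x =
      ∑ j, (F x j * pd i (fun y => G y j) x + pd i (fun y => F y j) x * G x j) := by
  simp only [← pd_mul i (hF _) (hG _)]
  simp only [pd, dot3, fderiv_fun_sum fun j _ => (hF j).fun_mul (hG j),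
    sum_apply]

theorem differentiableAt_dot3 {F G : (Fin 3 → ℝ) → Fin 3 → ℝ} {x : Fin 3 → ℝ}
    (hF : ∀ j, DifferentiableAt ℝ (fun y => F y j) x)
    (hG : ∀ j, DifferentiableAt ℝ (fun y => G y j) x) :
    DifferentiableAt ℝ (fun y => dot3 (F y) (G y)) x :=
  DifferentiableAt.fun_sum fun j _ => (hF j).fun_mul (hG j)

theorem div3_smul_sub_smul {f g : (Fin 3 → ℝ) → ℝ} {F G : (Fin 3 → ℝ) → Fin 3 → ℝ}
    {x : Fin 3 → ℝ} (hf : DifferentiableAt ℝ f x) (hg : DifferentiableAt ℝ g x)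
    (hF : ∀ j, DifferentiableAt ℝ (fun y => F y j) x)
    (hG : ∀ j, DifferentiableAt ℝ (fun y => G y j) x) :
    div3 (fun y => f y • F y - g y • G y) x =
      (f x * div3 F x + ∑ i, pd i f x * F x i) -
        (g x * div3 G x + ∑ i, pd i g x * G x i) := by
  simp only [div3, Pi.sub_apply, Pi.smul_apply, smul_eq_mul, Finset.mul_sum,
    ← Finset.sum_add_distrib, ← Finset.sum_sub_distrib]
  refine Finset.sum_congr rfl fun i _ => ?_
  rw [pd_sub i (hf.fun_mul (hF i)) (hg.fun_mul (hG i)), pd_mul i hf (hF i), pd_mul i hg (hG i)]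

theorem differentiableAt_η₃ (j : Fin 3) (x : Fin 3 → ℝ) :
    DifferentiableAt ℝ (fun y => η₃ y j) x := by
  fin_cases j <;> simp [η₃] <;> fun_prop

theorem div3_η₃ (x : Fin 3 → ℝ) : div3 η₃ x = 0 := by
  simp [div3, pd, η₃, Fin.sum_univ_three, fderiv_apply]

/-- If `E` is a divergence-free, axially symmetric (`[η, E] = 0`) C¹ vector field on ℝ³
and `A` is a C¹ vector field, then the angular component of `E × curl A` is the total
divergence `div(⟨E, A⟩η − ⟨A, η⟩E)`. -/
theorem angular_momentum_density_is_divergence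
    (E A : (Fin 3 → ℝ) → Fin 3 → ℝ)
    (hE : ContDiff ℝ 1 E) (hA : ContDiff ℝ 1 A)
    (hdiv : ∀ x, div3 E x = 0)
    (hsym : ∀ x j, (∑ i, η₃ x i * pd i (fun y => E y j) x) =
      ∑ i, E x i * pd i (fun y => η₃ y j) x) :
    ∀ x, dot3 (cross3 (E x) (curl3 A x)) (η₃ x) =
      div3 (fun y => dot3 (E y) (A y) • η₃ y - dot3 (A y) (η₃ y) • E y) x := by
  intro x
  have hE' : ∀ j, DifferentiableAt ℝ (fun y => E y j) x := fun j =>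
    differentiableAt_pi.1 (hE.differentiable one_ne_zero x) j
  have hA' : ∀ j, DifferentiableAt ℝ (fun y => A y j) x := fun j =>
    differentiableAt_pi.1 (hA.differentiable one_ne_zero x) j
  have hη : ∀ j, DifferentiableAt ℝ (fun y => η₃ y j) x := fun j => differentiableAt_η₃ j x
  rw [div3_smul_sub_smul (differentiableAt_dot3 hE' hA') (differentiableAt_dot3 hA' hη) hη hE',
    div3_η₃, hdiv]
  simp only [pd_dot3 _ hE' hA', pd_dot3 _ hA' hη]
  have h0 := hsym x 0
  have h1 := hsym x 1
  have h2 := hsym x 2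
  simp only [Fin.sum_univ_three] at h0 h1 h2 ⊢
  simp only [dot3, cross3, curl3, Fin.sum_univ_three, Matrix.cons_val]
  linear_combination -A x 0 * h0 - A x 1 * h1 - A x 2 * h2

end
end

section
/- Let g be a real constant, let r = √(x² + y² + z²), let η(x, y, z) = (−y, x, 0), and define A₊(x, y, z) = (g/(r(r + z)))·(−y, x, 0) and A₋(x, y, z) = (g/(r(z − r)))·(−y, x, 0), each defined off its Dirac string on the z-axis. Then for every R > 0, the integral of ⟨A₊, η⟩ + ⟨A₋, η⟩ over the sphere of radius R centered at the origin, with respect to the 2-dimensional Hausdorff measure, is zero. -/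
open Real MeasureTheory

noncomputable section

/-- Euclidean distance to the origin. -/
def rad (p : EuclideanSpace ℝ (Fin 3)) : ℝ := Real.sqrt (p 0 ^ 2 + p 1 ^ 2 + p 2 ^ 2)

/-- The rotational vector field `η(x, y, z) = (−y, x, 0)`. -/
def ηE (p : EuclideanSpace ℝ (Fin 3)) : Fin 3 → ℝ := ![-(p 1), p 0, 0]

/-- The Dirac-string vector potential with string on the nonpositive z-axis. -/
def AplusE (g : ℝ) (p : EuclideanSpace ℝ (Fin 3)) : Fin 3 → ℝ :=
  (g / (rad p * (rad p + p 2))) • ηE p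

/-- The Dirac-string vector potential with string on the nonnegative z-axis. -/
def AminusE (g : ℝ) (p : EuclideanSpace ℝ (Fin 3)) : Fin 3 → ℝ :=
  (g / (rad p * (p 2 - rad p))) • ηE p

/-- The integrand changes sign under the antipodal map. -/
theorem dot3_AplusE_add_dot3_AminusE_neg (g : ℝ) (p : EuclideanSpace ℝ (Fin 3)) :
    dot3 (AplusE g (-p)) (ηE (-p)) + dot3 (AminusE g (-p)) (ηE (-p)) =
      -(dot3 (AplusE g p) (ηE p) + dot3 (AminusE g p) (ηE p)) := by
  have hrad : rad (-p) = rad p := by simp [rad]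
  have hη : ηE (-p) = -ηE p := by
    ext i
    fin_cases i <;> simp [ηE]
  have hdot (c : ℝ) (v : Fin 3 → ℝ) : dot3 (c • v) v = c * dot3 v v := by
    simp [dot3, Finset.mul_sum, mul_assoc]
  have hneg (v : Fin 3 → ℝ) : dot3 (-v) (-v) = dot3 v v := by simp [dot3]
  have hplus : g / (rad p * (rad p + -p 2)) = -(g / (rad p * (p 2 - rad p))) := by
    rw [← div_neg]
    ring_nf
  have hminus : g / (rad p * (-p 2 - rad p)) = -(g / (rad p * (rad p + p 2))) := by
    rw [← div_neg]
    ring_nf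
  simp only [AplusE, AminusE, hdot, hη, hneg, hrad, PiLp.neg_apply, hplus, hminus]
  ring

/-- An odd function has zero integral over any centered sphere, with respect to any Hausdorff
measure. -/
theorem setIntegral_sphere_hausdorffMeasure_eq_zero_of_odd {E : Type*} [NormedAddCommGroup E]
    [MeasurableSpace E] [BorelSpace E] (d R : ℝ) {f : E → ℝ} (hf : ∀ p, f (-p) = -f p) :
    ∫ p in Metric.sphere (0 : E) R, f p ∂μH[d] = 0 := by
  have hmp : MeasurePreserving (Neg.neg : E → E) μH[d] μH[d] :=
    (IsometryEquiv.neg E).measurePreserving_hausdorffMeasure d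
  have h := hmp.setIntegral_preimage_emb (MeasurableEquiv.neg E).measurableEmbedding f
    (Metric.sphere 0 R)
  have hpre : (Neg.neg : E → E) ⁻¹' Metric.sphere 0 R = Metric.sphere 0 R := by
    ext p
    simp
  simp only [hpre, hf, integral_neg] at h
  linarith

/-- The integral of `⟨A₊, η⟩ + ⟨A₋, η⟩` over any sphere of radius `R > 0` about the
origin, with respect to the 2-dimensional Hausdorff measure, vanishes. -/
theorem averaged_dirac_potential_integral_zero (g R : ℝ) (hR : 0 < R) :
    ∫ p in Metric.sphere (0 : EuclideanSpace ℝ (Fin 3)) R,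
      (dot3 (AplusE g p) (ηE p) + dot3 (AminusE g p) (ηE p)) ∂μH[2] = 0 := by
  exact setIntegral_sphere_hausdorffMeasure_eq_zero_of_odd 2 R
    (dot3_AplusE_add_dot3_AminusE_neg g)

end
end
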